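/- arXiv:1506.03125 — 3 statements merged into one kernel-verified Lean document; each statement's English description precedes it below -/
import Mathlib

section
/- Let M be a random n × n real symmetric matrix whose distribution is orthogonally invariant (i.e., for every fixed n × n real orthogonal matrix U, the matrix U M Uᵀ has the same distribution as M) and whose spectrum is almost surely simple (all n eigenvalues are distinct). Then for every deterministic nonzero vector b ∈ ℝⁿ, the pair (M, b) is controllable with probability one. -/
open MeasureTheory ProbabilityTheory Matrix

/-- The pair `(A, b)` is controllable if the `n × n` matrix whose columns are
`b, A b, A^2 b, …, A^(n-1) b` has rank `n`. -/
def Controllable {n : ℕ} {R : Type*} [CommRing R] (A : Matrix (Fin n) (Fin n) R)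
    (b : Fin n → R) : Prop :=
  (Matrix.of fun (i k : Fin n) => ((A ^ (k : ℕ)) *ᵥ b) i).rank = n

/-- A real symmetric matrix has simple spectrum if all of its `n` eigenvalues are distinct. -/
def HasSimpleSpectrum {n : ℕ} (A : Matrix (Fin n) (Fin n) ℝ) : Prop :=
  ∀ hA : A.IsHermitian, Function.Injective hA.eigenvalues

/-- The matrix with columns `b, A b, …, A^(n-1) b`. -/
def controllabilityMatrix {n : ℕ} (A : Matrix (Fin n) (Fin n) ℝ) (b : Fin n → ℝ) :
    Matrix (Fin n) (Fin n) ℝ :=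
  Matrix.of fun i k => ((A ^ (k : ℕ)) *ᵥ b) i

theorem controllable_of_det_ne_zero {n : ℕ} {A : Matrix (Fin n) (Fin n) ℝ} {b : Fin n → ℝ}
    (h : (controllabilityMatrix A b).det ≠ 0) : Controllable A b := by
  have := rank_of_isUnit _ ((isUnit_iff_isUnit_det _).2 h.isUnit)
  rwa [Fintype.card_fin] at this

theorem continuous_det_controllabilityMatrix {n : ℕ} (b : Fin n → ℝ) :
    Continuous fun A : Matrix (Fin n) (Fin n) ℝ => (controllabilityMatrix A b).det := by
  refine Continuous.matrix_det (continuous_matrix fun i k => ?_)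
  exact (continuous_apply i).comp ((continuous_id.pow _).matrix_mulVec continuous_const)

theorem det_controllabilityMatrix_smul {n : ℕ} (A : Matrix (Fin n) (Fin n) ℝ) (c : ℝ)
    (b : Fin n → ℝ) :
    (controllabilityMatrix A (c • b)).det = c ^ n * (controllabilityMatrix A b).det := by
  have : controllabilityMatrix A (c • b) = c • controllabilityMatrix A b := by
    ext i k
    simp [controllabilityMatrix, mulVec_smul]
  rw [this, det_smul, Fintype.card_fin]

theorem conj_orthogonal_pow {n : ℕ} {O : Matrix (Fin n) (Fin n) ℝ}
    (hO : O ∈ Matrix.orthogonalGroup (Fin n) ℝ) (A : Matrix (Fin n) (Fin n) ℝ) (k : ℕ) :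
    (O * A * Oᵀ) ^ k = O * A ^ k * Oᵀ := by
  have h₁ : O * Oᵀ = 1 := (mem_orthogonalGroup_iff (Fin n) ℝ).1 hO
  have h₂ : Oᵀ * O = 1 := (mem_orthogonalGroup_iff' (Fin n) ℝ).1 hO
  induction k with
  | zero => simp [h₁]
  | succ k ih =>
    calc (O * A * Oᵀ) ^ (k + 1) = O * A ^ k * (Oᵀ * O) * A * Oᵀ := by
          rw [pow_succ, ih]; simp only [Matrix.mul_assoc]
      _ = O * A ^ (k + 1) * Oᵀ := by rw [h₂, pow_succ]; simp only [Matrix.mul_assoc, Matrix.one_mul]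

theorem controllabilityMatrix_conj_orthogonal {n : ℕ} {O : Matrix (Fin n) (Fin n) ℝ}
    (hO : O ∈ Matrix.orthogonalGroup (Fin n) ℝ) (A : Matrix (Fin n) (Fin n) ℝ) (b : Fin n → ℝ) :
    controllabilityMatrix (O * A * Oᵀ) b = O * controllabilityMatrix A (Oᵀ *ᵥ b) := by
  ext i k
  simp only [controllabilityMatrix, of_apply, conj_orthogonal_pow hO, ← mulVec_mulVec]
  rfl

theorem controllabilityMatrix_diagonal {n : ℕ} (d w : Fin n → ℝ) :
    controllabilityMatrix (diagonal d) w = diagonal w * vandermonde d := by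
  ext i k
  simp [controllabilityMatrix, diagonal_pow, mulVec_diagonal, vandermonde_apply, mul_comm]

theorem det_ne_zero_of_mem_orthogonalGroup {n : ℕ} {O : Matrix (Fin n) (Fin n) ℝ}
    (hO : O ∈ Matrix.orthogonalGroup (Fin n) ℝ) : O.det ≠ 0 :=
  (UnitaryGroup.det_isUnit (⟨O, hO⟩ : Matrix.orthogonalGroup (Fin n) ℝ)).ne_zero

/-- The point `(1, k, k², …, k^(n-1))` of the moment curve. -/
def momentVector (n k : ℕ) : Fin n → ℝ := fun i => (k : ℝ) ^ (i : ℕ)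

theorem momentVector_ne_zero {n : ℕ} [NeZero n] (k : ℕ) : momentVector n k ≠ 0 := fun h => by
  simpa [momentVector] using congrFun h 0

theorem finite_dotProduct_momentVector_eq_zero {n : ℕ} {v : Fin n → ℝ} (hv : v ≠ 0) :
    {k : ℕ | v ⬝ᵥ momentVector n k = 0}.Finite := by
  set p : Polynomial ℝ := ∑ i : Fin n, Polynomial.monomial (i : ℕ) (v i) with hp
  have hp0 : p ≠ 0 := by
    obtain ⟨i, hi⟩ := Function.ne_iff.1 hv
    intro h
    apply hi
    have := congrArg (fun q : Polynomial ℝ => q.coeff i) h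
    simpa [hp, Polynomial.finsetSum_coeff, Polynomial.coeff_monomial, Fin.val_inj] using this
  refine ((Polynomial.finite_setOfPred_isRoot hp0).preimage
    (Nat.cast_injective (R := ℝ)).injOn).subset fun k hk => ?_
  simpa [hp, Polynomial.eval_finsetSum, dotProduct, momentVector] using hk

theorem finite_det_controllabilityMatrix_momentVector_eq_zero {n : ℕ}
    {A : Matrix (Fin n) (Fin n) ℝ} (hA : A.IsSymm) (hs : HasSimpleSpectrum A) :
    {k : ℕ | (controllabilityMatrix A (momentVector n k)).det = 0}.Finite := by
  have hH : A.IsHermitian := by rw [IsHermitian, conjTranspose_eq_transpose_of_trivial, hA]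
  set U : Matrix (Fin n) (Fin n) ℝ := hH.eigenvectorUnitary.1
  have hU : U ∈ Matrix.orthogonalGroup (Fin n) ℝ := hH.eigenvectorUnitary.2
  have hspec : A = U * diagonal hH.eigenvalues * Uᵀ := by
    have := hH.spectral_theorem
    rwa [Unitary.conjStarAlgAut_apply] at this
  have hrow (j : Fin n) : Uᵀ j ≠ 0 := fun h => det_ne_zero_of_mem_orthogonalGroup hU <| by
    rw [← det_transpose]
    exact det_eq_zero_of_row_eq_zero j (congrFun h)
  refine (Set.finite_iUnion fun j => finite_dotProduct_momentVector_eq_zero (hrow j)).subset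
    fun k hk => ?_
  rw [Set.mem_ofPred_eq, hspec, controllabilityMatrix_conj_orthogonal hU,
    controllabilityMatrix_diagonal, det_mul, det_mul, det_diagonal] at hk
  have hk' := (mul_eq_zero.1 ((mul_eq_zero.1 hk).resolve_left
    (det_ne_zero_of_mem_orthogonalGroup hU))).resolve_right (det_vandermonde_ne_zero_iff.2 (hs hH))
  obtain ⟨j, -, hj⟩ := Finset.prod_eq_zero_iff.1 hk'
  exact Set.mem_iUnion.2 ⟨j, hj⟩

/-- The orthogonal group acts transitively on lines. -/
theorem exists_orthogonal_transpose_mulVec_eq_smul {n : ℕ} {b w : Fin n → ℝ} (hb : b ≠ 0)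
    (hw : w ≠ 0) : ∃ O ∈ Matrix.orthogonalGroup (Fin n) ℝ, ∃ c : ℝ, c ≠ 0 ∧ Oᵀ *ᵥ b = c • w := by
  set b' : EuclideanSpace ℝ (Fin n) := WithLp.toLp 2 b
  set w' : EuclideanSpace ℝ (Fin n) := WithLp.toLp 2 w
  have hb' : ‖b'‖ ≠ 0 := by simpa [b'] using hb
  have hw' : ‖w'‖ ≠ 0 := by simpa [w'] using hw
  set c : ℝ := ‖b'‖ / ‖w'‖
  have hc : ‖b'‖ = ‖c • w'‖ := by
    rw [norm_smul, Real.norm_of_nonneg (by positivity), div_mul_cancel₀ _ hw']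
  set e := EuclideanSpace.basisFun (Fin n) ℝ
  set f := (ℝ ∙ (b' - c • w'))ᗮ.reflection
  set P := LinearMap.toMatrix e.toBasis e.toBasis f.toLinearEquiv.toLinearMap
  have hP : P ∈ Matrix.orthogonalGroup (Fin n) ℝ := f.toMatrix_mem_unitaryGroup e e
  refine ⟨Pᵀ, transpose_mem_unitaryGroup_iff.2 hP, c, div_ne_zero hb' hw', ?_⟩
  have h := LinearMap.toMatrix_mulVec_repr e.toBasis e.toBasis f.toLinearEquiv.toLinearMap b'
  have hf : f b' = c • w' := Submodule.reflection_sub hc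
  ext i
  have hi := congrFun h i
  have hrepr : ⇑(e.toBasis.repr b') = b := by ext; simp [e, b']
  rw [hrepr] at hi
  rw [transpose_transpose]
  refine hi.trans ?_
  simp [hf, e, w']

/-- Controllability for orthogonally invariant ensembles: if the distribution of the
random real symmetric matrix `M` is orthogonally invariant and its spectrum is almost
surely simple, then `(M, b)` is controllable with probability one for any nonzero `b`. -/
theorem controllability_orthogonally_invariant
    {Ω : Type*} [MeasurableSpace Ω] (μ : Measure Ω) [IsProbabilityMeasure μ]
    {n : ℕ} (M : Ω → Matrix (Fin n) (Fin n) ℝ)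
    (hMmeas : Measurable fun ω (i j : Fin n) => M ω i j)
    (hMsymm : ∀ ω, (M ω).IsSymm)
    (hinv : ∀ O : Matrix.orthogonalGroup (Fin n) ℝ,
      Measure.map (fun ω (i j : Fin n) =>
          ((O : Matrix (Fin n) (Fin n) ℝ) * M ω * (O : Matrix (Fin n) (Fin n) ℝ)ᵀ) i j) μ
        = Measure.map (fun ω (i j : Fin n) => M ω i j) μ)
    (hsimple : ∀ᵐ ω ∂μ, HasSimpleSpectrum (M ω))
    (b : Fin n → ℝ) (hb : b ≠ 0) :
    μ {ω | Controllable (M ω) b} = 1 := by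
  have : NeZero n := ⟨by rintro rfl; exact hb (Subsingleton.elim _ _)⟩
  let X : Ω → Fin n → Fin n → ℝ := fun ω i j => M ω i j
  let bad (w : Fin n → ℝ) : Set (Fin n → Fin n → ℝ) :=
    {A | (controllabilityMatrix (Matrix.of A) w).det = 0}
  have hbad (w : Fin n → ℝ) : MeasurableSet (bad w) := by
    have h : Continuous fun A : Fin n → Fin n → ℝ => (controllabilityMatrix (Matrix.of A) w).det :=
      continuous_det_controllabilityMatrix w
    exact h.measurable (measurableSet_singleton 0)
  have heq (k : ℕ) : μ (X ⁻¹' bad (momentVector n k)) = μ (X ⁻¹' bad b) := by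
    obtain ⟨O, hO, c, hc, hOb⟩ :=
      exists_orthogonal_transpose_mulVec_eq_smul hb (momentVector_ne_zero k)
    have hconj : Continuous fun (A : Fin n → Fin n → ℝ) (i j : Fin n) =>
        (O * Matrix.of A * Oᵀ) i j :=
      show Continuous fun A : Matrix (Fin n) (Fin n) ℝ => O * A * Oᵀ by fun_prop
    rw [← Measure.map_apply hMmeas (hbad b), ← hinv ⟨O, hO⟩]
    refine Eq.trans ?_ (Measure.map_apply (hconj.measurable.comp hMmeas) (hbad b)).symm
    congr 1
    ext ω
    change (controllabilityMatrix (M ω) (momentVector n k)).det = 0 ↔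
      (controllabilityMatrix (O * M ω * Oᵀ) b).det = 0
    rw [controllabilityMatrix_conj_orthogonal hO, hOb, det_mul, det_controllabilityMatrix_smul]
    simp [det_ne_zero_of_mem_orthogonalGroup hO, hc]
  have hlim : Filter.Tendsto (fun k => μ (X ⁻¹' bad (momentVector n k))) Filter.atTop
      (nhds (μ ∅)) := by
    refine tendsto_measure_of_ae_tendsto_indicator_of_isFiniteMeasure Filter.atTop
      MeasurableSet.empty (fun k => hMmeas (hbad _)) ?_
    filter_upwards [hsimple] with ω hω
    have hfin := finite_det_controllabilityMatrix_momentVector_eq_zero (hMsymm ω) hω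
    rw [← Nat.cofinite_eq_atTop]
    filter_upwards [hfin.compl_mem_cofinite] with k hk
    exact iff_of_false hk (Set.notMem_empty ω)
  have hzero : μ (X ⁻¹' bad b) = 0 := by
    simp_rw [heq, measure_empty] at hlim
    exact tendsto_nhds_unique tendsto_const_nhds hlim
  rw [← prob_compl_eq_one_iff (hMmeas (hbad b))] at hzero
  refine le_antisymm prob_le_one (hzero ▸ measure_mono fun ω hω => ?_)
  exact controllable_of_det_ne_zero hω
end

section
/- Let A_n be an n × n Hermitian matrix written in block form A_n = [[A_{n−1}, X], [X*, d]], where A_{n−1} is the upper-left (n−1) × (n−1) minor, X ∈ ℂ^{n−1}, and d ∈ ℝ. Let λ be an eigenvalue of A_n with unit eigenvector (v, x), where v ∈ ℂ^{n−1} and x ∈ ℂ is the last coordinate. Suppose that no eigenvalue of A_{n−1} equals λ. Then, for any orthonormal basis v_1(A_{n−1}), …, v_{n−1}(A_{n−1}) of eigenvectors of A_{n−1} with corresponding eigenvalues λ_1(A_{n−1}) ≤ … ≤ λ_{n−1}(A_{n−1}), one has |x|² = 1 / (1 + Σ_{j=1}^{n−1} (λ_j(A_{n−1}) − λ)^{−2}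 · |v_j(A_{n−1})* X|²). In particular, x ≠ 0. -/
open Matrix

/-- Parseval's identity for a family of `n` orthonormal vectors in `ℂⁿ`. -/
theorem sum_norm_sq_star_dotProduct {n : ℕ} (V : Fin n → Fin n → ℂ)
    (horth : ∀ j k : Fin n, star (V j) ⬝ᵥ V k = if j = k then 1 else 0) (u : Fin n → ℂ) :
    ∑ j, ‖star (V j) ⬝ᵥ u‖ ^ 2 = ∑ i, ‖u i‖ ^ 2 := by
  have norm_sq_eq (z : Fin n → ℂ) : ((∑ i, ‖z i‖ ^ 2 : ℝ) : ℂ) = star z ⬝ᵥ z := by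
    simp [dotProduct, Complex.conj_mul']
  let M : Matrix (Fin n) (Fin n) ℂ := Matrix.of fun j i => star (V j i)
  have hM : M * Mᴴ = 1 := by
    ext j k
    simpa [M, Matrix.mul_apply, dotProduct, Matrix.one_apply] using horth j k
  have hM' : Mᴴ * M = 1 := mul_eq_one_comm.mp hM
  have key : star (M *ᵥ u) ⬝ᵥ (M *ᵥ u) = star u ⬝ᵥ u := by
    rw [star_mulVec, ← dotProduct_mulVec, mulVec_mulVec, hM', one_mulVec]
  rw [← norm_sq_eq, ← norm_sq_eq] at key
  exact_mod_cast key

/-- A real number with a nonzero eigenvector is one of the listed eigenvalues of a Hermitian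
matrix. -/
theorem Matrix.IsHermitian.exists_eigenvalues_eq_of_mulVec_eq {n : ℕ}
    {B : Matrix (Fin n) (Fin n) ℂ} (hB : B.IsHermitian) {u : Fin n → ℂ} (hu : u ≠ 0) {μ : ℝ}
    (h : B *ᵥ u = (μ : ℂ) • u) : ∃ j, hB.eigenvalues j = μ := by
  have hmem : μ ∈ spectrum ℝ B := by
    rw [spectrum.mem_iff, Matrix.isUnit_iff_isUnit_det, isUnit_iff_ne_zero, not_not,
      ← Matrix.exists_mulVec_eq_zero_iff]
    refine ⟨u, hu, ?_⟩
    rw [sub_mulVec, h, Algebra.algebraMap_eq_smul_one, smul_mulVec, one_mulVec]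
    ext i
    simp
  rwa [hB.spectrum_real_eq_range_eigenvalues] at hmem

/-- Formula for the last coordinate of a unit eigenvector of a Hermitian matrix whose
eigenvalue avoids the spectrum of the top-left minor. -/
theorem eigenvector_last_coordinate_formula
    {n : ℕ} (A : Matrix (Fin (n + 1)) (Fin (n + 1)) ℂ) (hA : A.IsHermitian)
    (B : Matrix (Fin n) (Fin n) ℂ)
    (hB : B = A.submatrix Fin.castSucc Fin.castSucc)
    (X : Fin n → ℂ) (hX : X = fun i => A i.castSucc (Fin.last n))
    (lam : ℝ) (w : Fin (n + 1) → ℂ)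
    (hunit : ∑ i, ‖w i‖ ^ 2 = 1)
    (heig : A *ᵥ w = (lam : ℂ) • w)
    (havoid : ∀ hB' : B.IsHermitian, ∀ j : Fin n, hB'.eigenvalues j ≠ lam)
    (V : Fin n → Fin n → ℂ) (L : Fin n → ℝ) (hmono : Monotone L)
    (horth : ∀ j k : Fin n, star (V j) ⬝ᵥ V k = if j = k then 1 else 0)
    (heigV : ∀ j : Fin n, B *ᵥ V j = (L j : ℂ) • V j) :
    ‖w (Fin.last n)‖ ^ 2 =
      1 / (1 + ∑ j, ((L j - lam) ^ 2)⁻¹ * ‖star (V j) ⬝ᵥ X‖ ^ 2) ∧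
    w (Fin.last n) ≠ 0 := by
  have hBh : B.IsHermitian := hB ▸ hA.submatrix _
  have hne (j : Fin n) : L j - lam ≠ 0 := by
    intro h
    have hV : V j ≠ 0 := by
      intro h0
      simpa [h0] using horth j j
    obtain ⟨k, hk⟩ := hBh.exists_eigenvalues_eq_of_mulVec_eq hV (heigV j)
    exact havoid hBh k (hk.trans (sub_eq_zero.mp h))
  set x := w (Fin.last n) with hx
  let v : Fin n → ℂ := fun i => w i.castSucc
  have hblock : B *ᵥ v + x • X = (lam : ℂ) • v := by
    ext i
    have h := congrFun heig i.castSucc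
    simp only [mulVec, dotProduct, Fin.sum_univ_castSucc] at h
    simp only [hB, hX, mulVec, dotProduct, Pi.add_apply, Pi.smul_apply, smul_eq_mul,
      submatrix_apply, v, hx, mul_comm (w (Fin.last n))]
    exact h
  have hcoord (j : Fin n) :
      ((L j - lam : ℝ) : ℂ) * (star (V j) ⬝ᵥ v) = -(x * (star (V j) ⬝ᵥ X)) := by
    have hleft : star (V j) ⬝ᵥ (B *ᵥ v) = (L j : ℂ) * (star (V j) ⬝ᵥ v) := by
      have h : star (V j) ᵥ* B = star (B *ᵥ V j) := by rw [star_mulVec, hBh.eq]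
      rw [dotProduct_mulVec, h, heigV]
      simp [star_smul, smul_dotProduct]
    have h := congrArg (fun z => star (V j) ⬝ᵥ z) hblock
    simp only [dotProduct_add, dotProduct_smul, smul_eq_mul, hleft] at h
    push_cast
    linear_combination h
  have hnorm (j : Fin n) : ‖star (V j) ⬝ᵥ v‖ ^ 2 =
      ‖x‖ ^ 2 * (((L j - lam) ^ 2)⁻¹ * ‖star (V j) ⬝ᵥ X‖ ^ 2) := by
    have h := congrArg (fun z : ℂ => ‖z‖ ^ 2) (hcoord j)
    simp only [norm_mul, norm_neg, Complex.norm_real, Real.norm_eq_abs, mul_pow, sq_abs] at h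
    have := hne j
    field_simp
    linarith
  have hmain : ‖x‖ ^ 2 *
      (1 + ∑ j, ((L j - lam) ^ 2)⁻¹ * ‖star (V j) ⬝ᵥ X‖ ^ 2) = 1 := by
    rw [Fin.sum_univ_castSucc, ← sum_norm_sq_star_dotProduct V horth v] at hunit
    simp only [hnorm, ← Finset.mul_sum] at hunit
    linarith
  refine ⟨eq_one_div_of_mul_eq_one_left hmain, ?_⟩
  intro h
  simp [h] at hmain
end

section
/- Let A_n be an n × n Hermitian matrix written in block form A_n = [[A_{n−1}, X], [X*, d]], where A_{n−1} is the upper-left (n−1) × (n−1) minor, X ∈ ℂ^{n−1}, and d ∈ ℝ. If some eigenvalue of A_n is also an eigenvalue of A_{n−1}, then there exists a unit eigenvector w of A_{n−1} such that X* w = 0. -/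
open Matrix

theorem Matrix.IsHermitian.star_mulVec_dotProduct {ι : Type*} [Fintype ι]
    {B : Matrix ι ι ℂ} (hB : B.IsHermitian) (v u : ι → ℂ) :
    star (B *ᵥ v) ⬝ᵥ u = star v ⬝ᵥ B *ᵥ u := by
  rw [star_mulVec, hB.eq, dotProduct_mulVec]

open scoped ComplexOrder in
theorem Matrix.IsHermitian.star_eq_of_mulVec_eq_smul {ι : Type*} [Fintype ι]
    {B : Matrix ι ι ℂ} (hB : B.IsHermitian) {z : ι → ℂ} (hz : z ≠ 0) {lam : ℂ}
    (h : B *ᵥ z = lam • z) : star lam = lam := by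
  have key := hB.star_mulVec_dotProduct z z
  rw [h, star_smul, smul_dotProduct, dotProduct_smul] at key
  exact mul_right_cancel₀ (dotProduct_star_self_eq_zero.not.mpr hz)
    (by simpa only [smul_eq_mul] using key)

theorem exists_smul_sum_norm_sq_eq_one {ι : Type*} [Fintype ι] {v : ι → ℂ} (hv : v ≠ 0) :
    ∃ s : ℂ, ∑ i, ‖(s • v) i‖ ^ 2 = 1 := by
  obtain ⟨j, hj⟩ := Function.ne_iff.mp hv
  have hpos : 0 < ∑ i, ‖v i‖ ^ 2 :=
    Finset.sum_pos' (fun i _ => by positivity)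
      ⟨j, Finset.mem_univ j, pow_pos (norm_pos_iff.mpr hj) 2⟩
  refine ⟨((√(∑ i, ‖v i‖ ^ 2))⁻¹ : ℝ), ?_⟩
  simp only [Pi.smul_apply, smul_eq_mul, norm_mul, mul_pow, ← Finset.mul_sum,
    Complex.norm_real, Real.norm_eq_abs, sq_abs, inv_pow]
  rw [Real.sq_sqrt hpos.le, inv_mul_cancel₀ hpos.ne']

/-- If an eigenvalue of a Hermitian matrix `A` is also an eigenvalue of its top-left
minor `B`, then some unit eigenvector `w` of `B` satisfies `X* w = 0`, where `X` is the
off-diagonal block. -/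
theorem shared_eigenvalue_gives_orthogonal_eigenvector
    {n : ℕ} (A : Matrix (Fin (n + 1)) (Fin (n + 1)) ℂ) (hA : A.IsHermitian)
    (B : Matrix (Fin n) (Fin n) ℂ)
    (hB : B = A.submatrix Fin.castSucc Fin.castSucc)
    (X : Fin n → ℂ) (hX : X = fun i => A i.castSucc (Fin.last n))
    (lam : ℂ)
    (hlamA : ∃ w : Fin (n + 1) → ℂ, w ≠ 0 ∧ A *ᵥ w = lam • w)
    (hlamB : ∃ z : Fin n → ℂ, z ≠ 0 ∧ B *ᵥ z = lam • z) :
    ∃ w : Fin n → ℂ, (∑ i, ‖w i‖ ^ 2 = 1) ∧ (∃ t : ℂ, B *ᵥ w = t • w) ∧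
      star X ⬝ᵥ w = 0 := by
  suffices h : ∃ v : Fin n → ℂ, v ≠ 0 ∧ B *ᵥ v = lam • v ∧ star X ⬝ᵥ v = 0 by
    obtain ⟨v, hv, hBv, hXv⟩ := h
    obtain ⟨s, hs⟩ := exists_smul_sum_norm_sq_eq_one hv
    refine ⟨s • v, hs, ⟨lam, ?_⟩, ?_⟩
    · rw [mulVec_smul, hBv, smul_comm]
    · rw [dotProduct_smul, hXv, smul_zero]
  obtain ⟨w, hw, hAw⟩ := hlamA
  obtain ⟨z, hz, hBz⟩ := hlamB
  have hBherm : B.IsHermitian := hB ▸ hA.submatrix _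
  set u : Fin n → ℂ := fun i => w i.castSucc
  have htop : B *ᵥ u + w (Fin.last n) • X = lam • u := by
    funext i
    have h := congrFun hAw i.castSucc
    simp only [mulVec, dotProduct, Fin.sum_univ_castSucc, Pi.smul_apply] at h
    simpa [hB, hX, u, mulVec, dotProduct, mul_comm] using h
  by_cases hc : w (Fin.last n) = 0
  · refine ⟨u, fun hu => hw ?_, by simpa [hc] using htop, ?_⟩
    · funext i
      exact Fin.lastCases hc (fun j => congrFun hu j) i
    · have h := congrFun hAw (Fin.last n)
      simp only [mulVec, dotProduct, Fin.sum_univ_castSucc, Pi.smul_apply, hc, mul_zero,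
        add_zero, smul_zero] at h
      simpa only [hX, dotProduct, Pi.star_apply, hA.apply] using h
  · refine ⟨z, hz, hBz, ?_⟩
    have h := congrArg (star z ⬝ᵥ ·) htop
    simp only [dotProduct_add, dotProduct_smul] at h
    rw [← hBherm.star_mulVec_dotProduct, hBz, star_smul, smul_dotProduct,
      hBherm.star_eq_of_mulVec_eq_smul hz hBz, add_eq_left, smul_eq_mul] at h
    rw [star_dotProduct, star_eq_zero]
    exact (mul_eq_zero.mp h).resolve_left hc
end
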